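/- Let A, B ∈ Sym(2n,ℝ) and let C := 2(BJA − AJB) ∈ Sym(2n,ℝ), so that Q_C = {Q_A, Q_B}. Let f, g be smooth real-valued functions on a neighborhood of 0 in ℝ^{2n} such that f(z) − Q_A(z) = O(|z|³) and g(z) − Q_B(z) = O(|z|³) as z → 0. Assume there exists v ∈ ℝ^{2n} with Q_A(v) = 0, Q_B(v) = 0 and Q_C(v) ≠ 0. Then for every ε > 0 there exists z ∈ ℝ^{2n} with 0 < |z| < ε such that f(z) = 0, g(z) = 0, and {f, g}(z) ≠ 0. -/

import Mathlib

open Matrix Topology Asymptotics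

/-- The standard symplectic matrix `J = [[0, I_n], [−I_n, 0]]` on `ℝ^{2n} = ℝ^n × ℝ^n`. -/
noncomputable def symplJ (n : ℕ) : Matrix (Fin n ⊕ Fin n) (Fin n ⊕ Fin n) ℝ :=
  Matrix.fromBlocks 0 1 (-1) 0

/-- The Poisson bracket `{f, g} = Σ_j (∂f/∂ξ_j ∂g/∂x_j − ∂f/∂x_j ∂g/∂ξ_j)` of two functions
on `ℝ^{2n}` with coordinates `z = (x, ξ)` (`Sum.inl` indexing `x`, `Sum.inr` indexing `ξ`). -/
noncomputable def poissonBracket {n : ℕ} (f g : ((Fin n ⊕ Fin n) → ℝ) → ℝ)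
    (z : (Fin n ⊕ Fin n) → ℝ) : ℝ :=
  ∑ j : Fin n,
    (fderiv ℝ f z (Pi.single (Sum.inr j) 1) * fderiv ℝ g z (Pi.single (Sum.inl j) 1) -
      fderiv ℝ f z (Pi.single (Sum.inl j) 1) * fderiv ℝ g z (Pi.single (Sum.inr j) 1))

open Filter Metric in
/-- If a family of maps `Φ t` vanishes at `v` in the limit and its derivatives tend to a surjective
linear map, then there are zeros of `Φ t` arbitrarily close to `v`. -/
theorem frequently_eq_zero_of_tendsto_fderiv {ι E G : Type*} [NormedAddCommGroup E]
    [NormedSpace ℝ E] [CompleteSpace E] [NormedAddCommGroup G] [NormedSpace ℝ G] [CompleteSpace G]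
    {l : Filter ι} [l.NeBot] {Φ : ι → E → G} {v : E} {S : E →L[ℝ] G} (hS : S.range = ⊤)
    (hd : ∀ᶠ p : ι × E in l ×ˢ 𝓝 v, DifferentiableAt ℝ (Φ p.1) p.2)
    (hD : Tendsto (fun p : ι × E => fderiv ℝ (Φ p.1) p.2) (l ×ˢ 𝓝 v) (𝓝 S))
    (h0 : Tendsto (fun t => Φ t v) l (𝓝 0)) :
    ∃ᶠ p : ι × E in l ×ˢ 𝓝 v, Φ p.1 p.2 = 0 := by
  intro hne
  obtain ⟨N, hN⟩ := S.exists_nonlinearRightInverse_of_surjective hS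
  have hN' : (0 : ℝ) < N.nnnorm := hN
  have hc : 0 < N.nnnorm⁻¹ / 2 := by positivity
  have hclose : ∀ᶠ p : ι × E in l ×ˢ 𝓝 v,
      ‖fderiv ℝ (Φ p.1) p.2 - S‖ ≤ (N.nnnorm⁻¹ / 2 : NNReal) := by
    filter_upwards [hD.eventually (closedBall_mem_nhds S (NNReal.coe_pos.2 hc))] with p hp
    rwa [← dist_eq_norm]
  obtain ⟨P, hP, Q, hQ, hPQ⟩ := eventually_prod_iff.1 ((hd.and hclose).and hne)
  obtain ⟨δ, hδ, hball⟩ := Metric.eventually_nhds_iff_ball.1 hQ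
  have hr : 0 < ((N.nnnorm : ℝ)⁻¹ - (N.nnnorm⁻¹ / 2 : NNReal)) * (δ / 2) := by
    have : (0 : ℝ) < (N.nnnorm : ℝ)⁻¹ := by positivity
    push_cast
    nlinarith
  obtain ⟨t, ht, ht0⟩ := (hP.and (h0.eventually (closedBall_mem_nhds 0 hr))).exists
  have happrox : ApproximatesLinearOn (Φ t) S (ball v δ) (N.nnnorm⁻¹ / 2) := fun x hx y hy =>
    (convex_ball v δ).norm_image_sub_le_of_norm_fderiv_le'
      (fun z hz => (hPQ ht (hball z hz)).1.1) (fun z hz => (hPQ ht (hball z hz)).1.2) hy hx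
  obtain ⟨w, hw, hw0⟩ := happrox.surjOn_closedBall_of_nonlinearRightInverse N (half_pos hδ).le
    (closedBall_subset_ball (half_lt_self hδ)) (mem_closedBall_comm.1 ht0)
  exact (hPQ ht (hball w (closedBall_subset_ball (half_lt_self hδ) hw))).2 hw0

open Metric in
/-- The derivative of a `C²` function of cubic order at `0` is `o(z)`. -/
theorem isLittleO_fderiv_of_isBigO_norm_pow_three {E : Type*} [NormedAddCommGroup E]
    [NormedSpace ℝ E] {R : E → ℝ} (hR : ContDiffAt ℝ 2 R 0)
    (hO : R =O[𝓝 0] fun z => ‖z‖ ^ 3) :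
    (fun z => fderiv ℝ R z) =o[𝓝 0] fun z => z := by
  have hR0 : fderiv ℝ R 0 = 0 :=
    (IsBigO.hasFDerivAt (x₀ := (0 : E)) (n := 3) (by simpa using hO) (by norm_num)).fderiv
  obtain ⟨C, hC, hCO⟩ := hO.exists_pos
  obtain ⟨K, s, hs, hK⟩ :=
    (hR.fderiv_right (m := 1) (by norm_num)).exists_lipschitzOnWith
  have hdiff : ∀ᶠ z in 𝓝 (0 : E), DifferentiableAt ℝ R z :=
    (hR.eventually (by simp)).mono fun z hz => hz.differentiableAt (by norm_num)
  obtain ⟨δ, hδ, hball⟩ := Metric.eventually_nhds_iff_ball.1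
    ((hdiff.and (Filter.eventually_mem_set.2 hs)).and hCO.bound)
  refine isLittleO_iff.2 fun c hc => ?_
  obtain ⟨η, hη, hη1, hηK⟩ : ∃ η : ℝ, 0 < η ∧ η ≤ 1 ∧ K * η ≤ c / 2 := by
    refine ⟨min 1 (c / (2 * (K + 1))), by positivity, min_le_left _ _, ?_⟩
    calc (K : ℝ) * min 1 (c / (2 * (K + 1))) ≤ (K + 1) * (c / (2 * (K + 1))) := by
          gcongr
          · linarith
          · exact min_le_right _ _
      _ = c / 2 := by field_simp
  have hρ : 0 < min (δ / 2) (c * η / (18 * C)) := by positivity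
  filter_upwards [ball_mem_nhds (0 : E) hρ] with z hz
  rw [mem_ball_zero_iff, lt_min_iff] at hz
  obtain ⟨hzδ, hzc⟩ := hz
  rw [lt_div_iff₀ (by positivity)] at hzc
  rcases eq_or_ne z 0 with rfl | hz0
  · simp [hR0]
  have hr : 0 < ‖z‖ := norm_pos_iff.2 hz0
  have hsub : closedBall z (η * ‖z‖) ⊆ ball 0 δ := fun y hy => by
    rw [mem_closedBall, dist_eq_norm] at hy
    rw [mem_ball_zero_iff]
    have := norm_le_norm_add_norm_sub' y z
    nlinarith
  have hzmem : z ∈ closedBall z (η * ‖z‖) := mem_closedBall_self (by positivity)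
  refine ContinuousLinearMap.opNorm_le_of_unit_norm (by positivity) fun u hu => ?_
  have hnorm : ‖(η * ‖z‖) • u‖ = η * ‖z‖ := by
    rw [norm_smul, hu, mul_one, Real.norm_of_nonneg (by positivity)]
  have hymem : z + (η * ‖z‖) • u ∈ closedBall z (η * ‖z‖) := by
    simp only [mem_closedBall, dist_self_add_left, hnorm, le_refl]
  have htaylor := (convex_closedBall z (η * ‖z‖)).norm_image_sub_le_of_norm_fderiv_le'
    (f := R) (φ := fderiv ℝ R z) (C := K * (η * ‖z‖))
    (fun x hx => (hball x (hsub hx)).1.1)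
    (fun x hx => (hK.norm_sub_le (hball x (hsub hx)).1.2 (hball z (hsub hzmem)).1.2).trans (by
      rw [mem_closedBall, dist_eq_norm] at hx
      gcongr)) hzmem hymem
  have hRz := (hball z (hsub hzmem)).2
  have hRy := (hball _ (hsub hymem)).2
  have hy : ‖z + (η * ‖z‖) • u‖ ≤ 2 * ‖z‖ := (norm_add_le _ _).trans (by rw [hnorm]; nlinarith)
  have hy3 : C * ‖z + (η * ‖z‖) • u‖ ^ 3 ≤ C * (2 * ‖z‖) ^ 3 := by gcongr
  rw [add_sub_cancel_left, hnorm, map_smul, smul_eq_mul] at htaylor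
  simp only [norm_pow, abs_norm, Real.norm_eq_abs] at hRz hRy htaylor ⊢
  have hkey : η * ‖z‖ * |fderiv ℝ R z u| ≤ η * ‖z‖ * (c * ‖z‖) := by
    have h1 : η * ‖z‖ * |fderiv ℝ R z u| ≤ 9 * C * ‖z‖ ^ 3 + K * (η * ‖z‖) * (η * ‖z‖) := by
      rw [← abs_of_pos (mul_pos hη hr), ← abs_mul, abs_of_pos (mul_pos hη hr)]
      rw [abs_le] at hRz hRy htaylor ⊢
      constructor <;> nlinarith
    have h2 : ‖z‖ * (18 * C) * ‖z‖ ^ 2 ≤ c * η * ‖z‖ ^ 2 := by gcongr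
    have h3 : K * η * (η * ‖z‖ ^ 2) ≤ c / 2 * (η * ‖z‖ ^ 2) := by gcongr
    nlinarith
  exact le_of_mul_le_mul_left hkey (by positivity)

section Rescaling

open Filter

variable {E : Type*} [NormedAddCommGroup E] [NormedSpace ℝ E] {T : E →L[ℝ] E →L[ℝ] ℝ} {f : E → ℝ}

theorem hasFDerivAt_apply_self (hT : ∀ x y, T x y = T y x) (z : E) :
    HasFDerivAt (fun z => T z z) ((2 : ℝ) • T z) z := by
  refine (T.hasFDerivAt.clm_apply (hasFDerivAt_id z)).congr_fderiv ?_
  ext y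
  simp [hT y z, two_mul]

theorem tendsto_smul_nhdsWithin_prod_nhds (v : E) :
    Tendsto (fun p : ℝ × E => p.1 • p.2) (𝓝[>] 0 ×ˢ 𝓝 v) (𝓝 0) := by
  have h : Tendsto (fun p : ℝ × E => p.1 • p.2) (𝓝 0 ×ˢ 𝓝 v) (𝓝 ((0 : ℝ) • v)) :=
    tendsto_fst.smul tendsto_snd
  rw [zero_smul] at h
  exact h.mono_left (prod_mono_left _ nhdsWithin_le_nhds)

/-- The derivative of a function with quadratic leading part `z ↦ T z z` at `0`, after rescaling. -/
theorem tendsto_inv_smul_fderiv_smul (hT : ∀ x y, T x y = T y x) (hf : ContDiffAt ℝ 2 f 0)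
    (hO : (fun z => f z - T z z) =O[𝓝 0] fun z => ‖z‖ ^ 3) (v : E) :
    Tendsto (fun p : ℝ × E => p.1⁻¹ • fderiv ℝ f (p.1 • p.2)) (𝓝[>] 0 ×ˢ 𝓝 v)
      (𝓝 ((2 : ℝ) • T v)) := by
  have hR : ContDiffAt ℝ 2 (fun z => f z - T z z) 0 :=
    hf.sub (T.contDiff.contDiffAt.clm_apply contDiffAt_id)
  have hsmul := tendsto_smul_nhdsWithin_prod_nhds v
  have ho := (isLittleO_fderiv_of_isBigO_norm_pow_three hR hO).comp_tendsto hsmul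
  have hbig : ((fun z : E => z) ∘ fun p : ℝ × E => p.1 • p.2) =O[𝓝[>] 0 ×ˢ 𝓝 v]
      (fun p : ℝ × E => p.1) := by
    have h1 : (fun p : ℝ × E => p.2) =O[𝓝[>] (0 : ℝ) ×ˢ 𝓝 v] (fun _ => (1 : ℝ)) :=
      tendsto_snd.isBigO_one ℝ
    simpa [Function.comp_def] using
      (isBigO_refl (fun p : ℝ × E => p.1) (𝓝[>] (0 : ℝ) ×ˢ 𝓝 v)).smul h1
  have hlim := (ho.trans_isBigO hbig).tendsto_inv_smul_nhds_zero
  have hT2 : Tendsto (fun p : ℝ × E => (2 : ℝ) • T p.2) (𝓝[>] 0 ×ˢ 𝓝 v) (𝓝 ((2 : ℝ) • T v)) :=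
    ((T.continuous.tendsto v).comp tendsto_snd).const_smul 2
  have hdiff : ∀ᶠ z in 𝓝 (0 : E), DifferentiableAt ℝ f z :=
    (hf.eventually (by simp)).mono fun z hz => hz.differentiableAt (by norm_num)
  have hpos : ∀ᶠ p : ℝ × E in 𝓝[>] 0 ×ˢ 𝓝 v, 0 < p.1 :=
    tendsto_fst.eventually self_mem_nhdsWithin
  have hsum := hlim.add hT2
  rw [zero_add] at hsum
  refine hsum.congr' ?_
  filter_upwards [hsmul.eventually hdiff, hpos] with p hp hp0
  have hsub := (hp.hasFDerivAt.sub (hasFDerivAt_apply_self hT (p.1 • p.2))).fderiv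
  simp only [Function.comp_apply]
  rw [show fderiv ℝ (fun z => f z - T z z) (p.1 • p.2) = _ from hsub, smul_sub, map_smul,
    smul_comm (2 : ℝ), inv_smul_smul₀ hp0.ne', sub_add_cancel]

/-- The values of a function with leading part `z ↦ T z z` along an isotropic ray. -/
theorem tendsto_inv_sq_mul_smul_of_apply_self_eq_zero
    (hO : (fun z => f z - T z z) =O[𝓝 0] fun z => ‖z‖ ^ 3) {v : E} (hv : T v v = 0) :
    Tendsto (fun t : ℝ => (t ^ 2)⁻¹ * f (t • v)) (𝓝[>] 0) (𝓝 0) := by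
  have hsmul : Tendsto (fun t : ℝ => t • v) (𝓝 0) (𝓝 0) :=
    (continuous_id.smul continuous_const).tendsto' _ _ (by simp)
  have h := hO.comp_tendsto hsmul
  have h3 : (fun t : ℝ => f (t • v)) =O[𝓝 0] fun t : ℝ => t ^ 3 := by
    have hb : ((fun z : E => ‖z‖ ^ 3) ∘ fun t : ℝ => t • v) =O[𝓝 0] fun t : ℝ => t ^ 3 := by
      refine IsBigO.of_bound (‖v‖ ^ 3) (Eventually.of_forall fun t => le_of_eq ?_)
      simp only [Function.comp_apply, norm_pow, norm_norm, norm_smul, norm_mul]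
      ring
    simpa [Function.comp_def, hv] using h.trans hb
  have h2 : (fun t : ℝ => f (t • v)) =o[𝓝 0] fun t : ℝ => t ^ 2 :=
    h3.trans_isLittleO (isLittleO_pow_pow (by norm_num))
  simpa using h2.tendsto_inv_smul_nhds_zero.mono_left nhdsWithin_le_nhds

end Rescaling

/-- The Poisson pairing of two covectors, so that
`{f, g}(z) = covectorPairing (df(z)) (dg(z))`. -/
noncomputable def covectorPairing {n : ℕ} (p q : ((Fin n ⊕ Fin n) → ℝ) →L[ℝ] ℝ) : ℝ :=
  ∑ j : Fin n, (p (Pi.single (Sum.inr j) 1) * q (Pi.single (Sum.inl j) 1) -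
    p (Pi.single (Sum.inl j) 1) * q (Pi.single (Sum.inr j) 1))

section CovectorPairing

variable {n : ℕ}

theorem covectorPairing_smul_smul (c d : ℝ) (p q : ((Fin n ⊕ Fin n) → ℝ) →L[ℝ] ℝ) :
    covectorPairing (c • p) (d • q) = c * d * covectorPairing p q := by
  simp only [covectorPairing, _root_.smul_apply, smul_eq_mul, Finset.mul_sum]
  exact Finset.sum_congr rfl fun j _ => by ring

theorem continuous_covectorPairing :
    Continuous fun pq : (((Fin n ⊕ Fin n) → ℝ) →L[ℝ] ℝ) × (((Fin n ⊕ Fin n) → ℝ) →L[ℝ] ℝ) =>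
      covectorPairing pq.1 pq.2 := by
  unfold covectorPairing
  fun_prop

theorem range_prod_eq_top_of_covectorPairing_ne_zero {p q : ((Fin n ⊕ Fin n) → ℝ) →L[ℝ] ℝ}
    (h : covectorPairing p q ≠ 0) : (p.prod q).range = ⊤ := by
  obtain ⟨j, -, hj⟩ := Finset.exists_ne_zero_of_sum_ne_zero h
  set x : (Fin n ⊕ Fin n) → ℝ := Pi.single (Sum.inr j) 1
  set y : (Fin n ⊕ Fin n) → ℝ := Pi.single (Sum.inl j) 1
  refine LinearMap.range_eq_top.2 fun cd => ?_
  refine ⟨((cd.1 * q y - cd.2 * p y) / (p x * q y - p y * q x)) • x +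
    ((cd.2 * p x - cd.1 * q x) / (p x * q y - p y * q x)) • y, Prod.ext ?_ ?_⟩
  all_goals
    simp only [ContinuousLinearMap.coe_coe, ContinuousLinearMap.prod_apply, map_add, map_smul,
      Prod.fst_add, Prod.snd_add, Prod.smul_fst, Prod.smul_snd, smul_eq_mul]
    rw [div_mul_eq_mul_div, div_mul_eq_mul_div, ← add_div, div_eq_iff hj]
    ring

theorem symplJ_mulVec (w : (Fin n ⊕ Fin n) → ℝ) :
    symplJ n *ᵥ w = Sum.elim (w ∘ Sum.inr) (-(w ∘ Sum.inl)) := by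
  simp [symplJ, Matrix.fromBlocks_mulVec, Matrix.neg_mulVec]

/-- The bilinear form of a matrix as a continuous bilinear map. -/
noncomputable def matrixForm (A : Matrix (Fin n ⊕ Fin n) (Fin n ⊕ Fin n) ℝ) :
    ((Fin n ⊕ Fin n) → ℝ) →L[ℝ] ((Fin n ⊕ Fin n) → ℝ) →L[ℝ] ℝ :=
  (Matrix.toBilin' A).toContinuousBilinearMap

theorem matrixForm_apply (A : Matrix (Fin n ⊕ Fin n) (Fin n ⊕ Fin n) ℝ)
    (v w : (Fin n ⊕ Fin n) → ℝ) : matrixForm A v w = v ⬝ᵥ A *ᵥ w :=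
  Matrix.toBilin'_apply' A v w

variable {A B : Matrix (Fin n ⊕ Fin n) (Fin n ⊕ Fin n) ℝ}

theorem dotProduct_mulVec_eq_mulVec_dotProduct (hA : A.IsSymm) (v w : (Fin n ⊕ Fin n) → ℝ) :
    v ⬝ᵥ A *ᵥ w = A *ᵥ v ⬝ᵥ w := by
  rw [Matrix.dotProduct_mulVec, ← Matrix.mulVec_transpose, hA.eq]

theorem matrixForm_comm (hA : A.IsSymm) (v w : (Fin n ⊕ Fin n) → ℝ) :
    matrixForm A v w = matrixForm A w v := by
  rw [matrixForm_apply, matrixForm_apply, dotProduct_mulVec_eq_mulVec_dotProduct hA,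
    dotProduct_comm]

/-- The Poisson bracket of two quadratic forms. -/
theorem covectorPairing_matrixForm (hA : A.IsSymm) (hB : B.IsSymm) (v : (Fin n ⊕ Fin n) → ℝ) :
    covectorPairing ((2 : ℝ) • matrixForm A v) ((2 : ℝ) • matrixForm B v) =
      v ⬝ᵥ ((2 : ℝ) • (B * symplJ n * A - A * symplJ n * B)) *ᵥ v := by
  rw [covectorPairing_smul_smul, Matrix.smul_mulVec, dotProduct_smul, Matrix.sub_mulVec,
    dotProduct_sub, ← Matrix.mulVec_mulVec, ← Matrix.mulVec_mulVec, ← Matrix.mulVec_mulVec,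
    ← Matrix.mulVec_mulVec, dotProduct_mulVec_eq_mulVec_dotProduct hA,
    dotProduct_mulVec_eq_mulVec_dotProduct hB, symplJ_mulVec, symplJ_mulVec]
  simp only [covectorPairing, matrixForm_apply, dotProduct_mulVec_eq_mulVec_dotProduct hA,
    dotProduct_mulVec_eq_mulVec_dotProduct hB, dotProduct_single_one]
  simp only [dotProduct,
    Fintype.sum_sum_type, Sum.elim_inl, Sum.elim_inr, Function.comp_apply, Pi.neg_apply,
    smul_eq_mul, ← Finset.sum_add_distrib, ← Finset.sum_sub_distrib, Finset.mul_sum]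
  exact Finset.sum_congr rfl fun j _ => by ring

end CovectorPairing

/-- **proof of Theorem 1.2.** Let `A, B ∈ Sym(2n,ℝ)` and
`C := 2(BJA − AJB)`, so that `Q_C = {Q_A, Q_B}`. Let `f, g` be smooth near `0` with
`f(z) = Q_A(z) + O(|z|³)` and `g(z) = Q_B(z) + O(|z|³)`. If there is `v` with
`Q_A(v) = Q_B(v) = 0` and `Q_C(v) ≠ 0`, then arbitrarily close to `0` there are points `z ≠ 0`
with `f(z) = g(z) = 0` and `{f, g}(z) ≠ 0` (Hörmander's condition). -/
theorem hoermander_points_near_double_characteristic {n : ℕ}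
    (A B : Matrix (Fin n ⊕ Fin n) (Fin n ⊕ Fin n) ℝ)
    (hAs : A.IsSymm) (hBs : B.IsSymm)
    (C : Matrix (Fin n ⊕ Fin n) (Fin n ⊕ Fin n) ℝ)
    (hC : C = (2 : ℝ) • (B * symplJ n * A - A * symplJ n * B))
    (f g : ((Fin n ⊕ Fin n) → ℝ) → ℝ)
    (U : Set ((Fin n ⊕ Fin n) → ℝ)) (hU : U ∈ 𝓝 (0 : (Fin n ⊕ Fin n) → ℝ))
    (hf : ContDiffOn ℝ (⊤ : ℕ∞) f U) (hg : ContDiffOn ℝ (⊤ : ℕ∞) g U)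
    (hfA : (fun z => f z - z ⬝ᵥ A.mulVec z) =O[𝓝 0] fun z => ‖z‖ ^ 3)
    (hgB : (fun z => g z - z ⬝ᵥ B.mulVec z) =O[𝓝 0] fun z => ‖z‖ ^ 3)
    (v : (Fin n ⊕ Fin n) → ℝ)
    (hvA : v ⬝ᵥ A.mulVec v = 0) (hvB : v ⬝ᵥ B.mulVec v = 0)
    (hvC : v ⬝ᵥ C.mulVec v ≠ 0) :
    ∀ ε > (0 : ℝ), ∃ z : (Fin n ⊕ Fin n) → ℝ, z ≠ 0 ∧ ‖z‖ < ε ∧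
      f z = 0 ∧ g z = 0 ∧ poissonBracket f g z ≠ 0 := by
  intro ε hε
  have hfA' : (fun z => f z - matrixForm A z z) =O[𝓝 0] fun z => ‖z‖ ^ 3 := by
    simpa only [matrixForm_apply] using hfA
  have hgB' : (fun z => g z - matrixForm B z z) =O[𝓝 0] fun z => ‖z‖ ^ 3 := by
    simpa only [matrixForm_apply] using hgB
  have hf2 : ContDiffAt ℝ 2 f 0 := (hf.contDiffAt hU).of_le (WithTop.coe_le_coe.2 le_top)
  have hg2 : ContDiffAt ℝ 2 g 0 := (hg.contDiffAt hU).of_le (WithTop.coe_le_coe.2 le_top)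
  have hpair : covectorPairing ((2 : ℝ) • matrixForm A v) ((2 : ℝ) • matrixForm B v) ≠ 0 := by
    rwa [covectorPairing_matrixForm hAs hBs, ← hC]
  have hv0 : v ≠ 0 := by
    rintro rfl
    simp at hvC
  have hDf := tendsto_inv_smul_fderiv_smul (matrixForm_comm hAs) hf2 hfA' v
  have hDg := tendsto_inv_smul_fderiv_smul (matrixForm_comm hBs) hg2 hgB' v
  have hsmul := tendsto_smul_nhdsWithin_prod_nhds v
  have hpos : ∀ᶠ p : ℝ × ((Fin n ⊕ Fin n) → ℝ) in 𝓝[>] 0 ×ˢ 𝓝 v, 0 < p.1 :=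
    Filter.tendsto_fst.eventually self_mem_nhdsWithin
  have hdf : ∀ᶠ z in 𝓝 0, DifferentiableAt ℝ f z :=
    (hf2.eventually (by simp)).mono fun z hz => hz.differentiableAt (by norm_num)
  have hdg : ∀ᶠ z in 𝓝 0, DifferentiableAt ℝ g z :=
    (hg2.eventually (by simp)).mono fun z hz => hz.differentiableAt (by norm_num)
  have hderiv : ∀ᶠ p : ℝ × ((Fin n ⊕ Fin n) → ℝ) in 𝓝[>] 0 ×ˢ 𝓝 v,
      HasFDerivAt (fun w => ((p.1 ^ 2)⁻¹ * f (p.1 • w), (p.1 ^ 2)⁻¹ * g (p.1 • w)))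
        ((p.1⁻¹ • fderiv ℝ f (p.1 • p.2)).prod (p.1⁻¹ • fderiv ℝ g (p.1 • p.2))) p.2 := by
    filter_upwards [hsmul.eventually hdf, hsmul.eventually hdg, hpos] with p hpf hpg hp
    have hscale {h : ((Fin n ⊕ Fin n) → ℝ) → ℝ} (hh : DifferentiableAt ℝ h (p.1 • p.2)) :
        HasFDerivAt (fun w => (p.1 ^ 2)⁻¹ * h (p.1 • w)) (p.1⁻¹ • fderiv ℝ h (p.1 • p.2)) p.2 := by
      refine ((hh.hasFDerivAt.comp p.2 ((hasFDerivAt_id p.2).const_smul p.1)).const_mul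
        (p.1 ^ 2)⁻¹).congr_fderiv ?_
      ext u
      simp
      field_simp
    exact (hscale hpf).prodMk (hscale hpg)
  have hprod : Filter.Tendsto (fun p : ℝ × ((Fin n ⊕ Fin n) → ℝ) =>
      (p.1⁻¹ • fderiv ℝ f (p.1 • p.2)).prod (p.1⁻¹ • fderiv ℝ g (p.1 • p.2)))
      (𝓝[>] 0 ×ˢ 𝓝 v)
      (𝓝 (((2 : ℝ) • matrixForm A v).prod ((2 : ℝ) • matrixForm B v))) :=
    ((ContinuousLinearMap.prodₗᵢ (𝕜 := ℝ) (E := (Fin n ⊕ Fin n) → ℝ) (F := ℝ) (G := ℝ)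
      ℝ).continuous.tendsto _).comp (hDf.prodMk_nhds hDg)
  have hzero := frequently_eq_zero_of_tendsto_fderiv
    (Φ := fun (t : ℝ) w => ((t ^ 2)⁻¹ * f (t • w), (t ^ 2)⁻¹ * g (t • w)))
    (range_prod_eq_top_of_covectorPairing_ne_zero hpair)
    (hderiv.mono fun p hp => hp.differentiableAt)
    (hprod.congr' (hderiv.mono fun p hp => hp.fderiv.symm))
    ((tendsto_inv_sq_mul_smul_of_apply_self_eq_zero hfA' (by rwa [matrixForm_apply])).prodMk_nhds
      (tendsto_inv_sq_mul_smul_of_apply_self_eq_zero hgB' (by rwa [matrixForm_apply])))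
  have hbracket := ((continuous_covectorPairing.tendsto _).comp
    (hDf.prodMk_nhds hDg)).eventually_ne hpair
  obtain ⟨⟨t, w⟩, htw, ht, hw, hsmall, hne⟩ := (hzero.and_eventually (hpos.and
    ((Filter.tendsto_snd.eventually_ne hv0).and
      ((hsmul.eventually (Metric.ball_mem_nhds 0 hε)).and hbracket)))).exists
  simp only [Prod.mk_eq_zero, mul_eq_zero, inv_eq_zero, pow_eq_zero_iff two_ne_zero,
    ne_of_gt ht, false_or] at htw
  refine ⟨t • w, smul_ne_zero (ne_of_gt ht) hw, mem_ball_zero_iff.1 hsmall, htw.1, htw.2, ?_⟩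
  simp only [Function.comp_apply, covectorPairing_smul_smul] at hne
  exact right_ne_zero_of_mul hne
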